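/- Let d ≥ 1 and m > 0, and define for ν ∈ P(ℝ^{2d}) the relative Fisher information I(ν|μ) := sup over φ ∈ C_c^∞(ℝ^{2d}) of 2∫_{ℝ^{2d}} [Δ_p φ − (p/m)·∇_p φ − (1/2)|∇_p φ|²] dν. If ν ∈ P(ℝ^{2d}) satisfies I(ν|μ) = 0, then there exists σ ∈ P(ℝ^d) such that ν(dq dp) = Z^{-1} exp(−p²/(2m)) σ(dq) dp, where Z = ∫_{ℝ^d} e^{−p²/(2m)} dp is the normalizing constant of the Maxwellian; i.e. ν is the product (in the disintegration over q) of σ with the Maxwellian distribution in p. -/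

import Mathlib

open MeasureTheory Real Filter Topology Set
open scoped ENNReal NNReal

noncomputable section

/-- Phase space ℝ^{2d} = ℝ^d_q × ℝ^d_p. -/
abbrev Phase (d : ℕ) := (Fin d → ℝ) × (Fin d → ℝ)

/-- The unit direction in the `p_i` coordinate. -/
def dirP {d : ℕ} (i : Fin d) : Phase d := (0, Pi.single i 1)

/-- Partial derivative in the `p_i` variable. -/
def pdP {d : ℕ} (φ : Phase d → ℝ) (x : Phase d) (i : Fin d) : ℝ :=
  fderiv ℝ φ x (dirP i)

/-- The Laplacian in the `p` variables. -/
def laplP {d : ℕ} (φ : Phase d → ℝ) (x : Phase d) : ℝ :=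
  ∑ i, fderiv ℝ (fun y => pdP φ y i) x (dirP i)

/-- `φ ∈ C_c^∞(ℝ^{2d})`. -/
def IsTestFn {d : ℕ} (φ : Phase d → ℝ) : Prop :=
  ContDiff ℝ (⊤ : ℕ∞) φ ∧ HasCompactSupport φ

/-- The integrand `Δ_p φ − (p/m)·∇_p φ − ½|∇_p φ|²` in the duality definition of the
relative Fisher information. -/
def fisherIntegrand {d : ℕ} (m : ℝ) (φ : Phase d → ℝ) (x : Phase d) : ℝ :=
  laplP φ x - (1 / m) * ∑ i, x.2 i * pdP φ x i - (1 / 2) * ∑ i, (pdP φ x i) ^ 2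

/-- The relative Fisher information (w.r.t. the `p`-variable) of a measure `ν` on ℝ^{2d}. -/
def relFisher {d : ℕ} (m : ℝ) (ν : Measure (Phase d)) : ℝ≥0∞ :=
  ⨆ φ : {φ : Phase d → ℝ // IsTestFn φ},
    ENNReal.ofReal (2 * ∫ x, fisherIntegrand m φ.1 x ∂ν)

/-- Normalization constant `Z = ∫_{ℝ^d} e^{−p²/(2m)} dp` of the Maxwellian. -/
def maxwellZ (d : ℕ) (m : ℝ) : ℝ :=
  ∫ p : Fin d → ℝ, Real.exp (-(∑ i, (p i) ^ 2) / (2 * m))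

/-- The Maxwellian probability distribution `Z⁻¹ e^{−p²/(2m)} dp` on ℝ^d_p. -/
def maxwellian (d : ℕ) (m : ℝ) : Measure (Fin d → ℝ) :=
  volume.withDensity
    (fun p => ENNReal.ofReal ((maxwellZ d m)⁻¹ * Real.exp (-(∑ i, (p i) ^ 2) / (2 * m))))

/-- The generator `Δ_p - (p/m)·∇_p`. -/
def pGen {d : ℕ} (m : ℝ) (φ : Phase d → ℝ) (x : Phase d) : ℝ :=
  laplP φ x - (1 / m) * ∑ i, x.2 i * pdP φ x i

section Calculus

variable {d : ℕ} {m : ℝ} {φ ψ : Phase d → ℝ}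

lemma laplP_eq_sum_pdP (φ : Phase d → ℝ) (x : Phase d) :
    laplP φ x = ∑ i, pdP (fun y => pdP φ y i) x i := rfl

lemma contDiff_pdP (h : ContDiff ℝ (⊤ : ℕ∞) φ) (i : Fin d) :
    ContDiff ℝ (⊤ : ℕ∞) (fun y => pdP φ y i) :=
  (h.fderiv_right (m := (⊤ : ℕ∞)) (by exact_mod_cast le_top)).clm_apply contDiff_const

lemma IsTestFn.pd (h : IsTestFn φ) (i : Fin d) : IsTestFn (fun y => pdP φ y i) :=
  ⟨contDiff_pdP h.1 i, h.2.fderiv_apply (𝕜 := ℝ) _⟩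

lemma IsTestFn.continuous (h : IsTestFn φ) : Continuous φ := h.1.continuous

lemma IsTestFn.differentiable (h : IsTestFn φ) : Differentiable ℝ φ :=
  h.1.differentiable (by simp)

lemma IsTestFn.mul_contDiff (h : IsTestFn φ) (hψ : ContDiff ℝ (⊤ : ℕ∞) ψ) :
    IsTestFn (fun x => φ x * ψ x) :=
  ⟨h.1.mul hψ, h.2.mul_right⟩

lemma IsTestFn.const_mul (h : IsTestFn φ) (c : ℝ) : IsTestFn (fun x => c * φ x) :=
  ⟨contDiff_const.mul h.1, h.2.mul_left⟩

lemma IsTestFn.comp_smul (h : IsTestFn φ) {c : ℝ} (hc : c ≠ 0) :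
    IsTestFn (fun x => φ (c • x)) :=
  ⟨h.1.comp (contDiff_const_smul c), h.2.comp_smul hc⟩

lemma IsTestFn.integrable_mul (h : IsTestFn φ) {g : Phase d → ℝ} (hg : Continuous g)
    (ν : Measure (Phase d)) [IsFiniteMeasure ν] : Integrable (fun x => g x * φ x) ν :=
  (hg.mul h.continuous).integrable_of_hasCompactSupport h.2.mul_left

lemma IsTestFn.integrable (h : IsTestFn φ) (ν : Measure (Phase d)) [IsFiniteMeasure ν] :
    Integrable φ ν :=
  h.continuous.integrable_of_hasCompactSupport h.2

lemma IsTestFn.exists_abs_mul_le (h : IsTestFn φ) {g : Phase d → ℝ} (hg : Continuous g) :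
    ∃ C, ∀ x, |g x * φ x| ≤ C :=
  (hg.mul h.continuous).bounded_above_of_compact_support h.2.mul_left

lemma IsTestFn.exists_abs_le (h : IsTestFn φ) : ∃ C, ∀ x, |φ x| ≤ C :=
  h.continuous.bounded_above_of_compact_support h.2

lemma IsTestFn.continuous_pGen (h : IsTestFn φ) (m : ℝ) : Continuous (pGen m φ) := by
  unfold pGen
  simp only [laplP_eq_sum_pdP]
  have h1 := fun i => (h.pd i).continuous
  have h2 := fun i => ((h.pd i).pd i).continuous
  fun_prop

lemma IsTestFn.integrable_pGen (h : IsTestFn φ) (m : ℝ) (ν : Measure (Phase d))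
    [IsFiniteMeasure ν] : Integrable (pGen m φ) ν := by
  refine (integrable_finsetSum _ fun i _ => ((h.pd i).pd i).integrable ν).sub
    ((integrable_finsetSum _ fun i _ => (h.pd i).integrable_mul ?_ ν).const_mul _)
  fun_prop

lemma IsTestFn.integrable_sum_sq_pdP (h : IsTestFn φ) (ν : Measure (Phase d))
    [IsFiniteMeasure ν] : Integrable (fun x => ∑ i, (pdP φ x i) ^ 2) ν := by
  simp only [pow_two]
  exact integrable_finsetSum _ fun i _ => (h.pd i).integrable_mul (h.pd i).continuous ν

lemma pdP_const_mul (h : Differentiable ℝ φ) (c : ℝ) (x : Phase d) (i : Fin d) :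
    pdP (fun y => c * φ y) x i = c * pdP φ x i := by
  simp [pdP, fderiv_const_mul (h x)]

lemma pdP_mul (h : Differentiable ℝ φ) (h' : Differentiable ℝ ψ) (x : Phase d) (i : Fin d) :
    pdP (fun y => φ y * ψ y) x i = φ x * pdP ψ x i + ψ x * pdP φ x i := by
  simp [pdP, fderiv_fun_mul (h x) (h' x)]

lemma pdP_add (h : Differentiable ℝ φ) (h' : Differentiable ℝ ψ) (x : Phase d) (i : Fin d) :
    pdP (fun y => φ y + ψ y) x i = pdP φ x i + pdP ψ x i := by
  simp [pdP, fderiv_fun_add (h x) (h' x)]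

lemma pdP_comp_smul (φ : Phase d → ℝ) (c : ℝ) (x : Phase d) (i : Fin d) :
    pdP (fun y => φ (c • y)) x i = c * pdP φ (c • x) i := by
  have : fderiv ℝ (fun y => φ (c • y)) x = c • fderiv ℝ φ (c • x) := fderiv_comp_smul c
  simp [pdP, this]

lemma pGen_const_mul (h : ContDiff ℝ (⊤ : ℕ∞) φ) (m c : ℝ) (x : Phase d) :
    pGen m (fun y => c * φ y) x = c * pGen m φ x := by
  have h0 : Differentiable ℝ φ := h.differentiable (by simp)
  have h1 := fun i => (contDiff_pdP h i).differentiable (by simp)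
  simp only [pGen, laplP_eq_sum_pdP, pdP_const_mul h0, fun i => pdP_const_mul (h1 i)]
  rw [mul_sub]
  simp only [Finset.mul_sum, mul_left_comm]

lemma pGen_mul (h : ContDiff ℝ (⊤ : ℕ∞) φ) (h' : ContDiff ℝ (⊤ : ℕ∞) ψ) (m : ℝ)
    (x : Phase d) :
    pGen m (fun y => φ y * ψ y) x =
      φ x * pGen m ψ x + ψ x * pGen m φ x + 2 * ∑ i, pdP φ x i * pdP ψ x i := by
  have d0 : Differentiable ℝ φ := h.differentiable (by simp)
  have d0' : Differentiable ℝ ψ := h'.differentiable (by simp)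
  have d1 := fun i => (contDiff_pdP h i).differentiable (by simp)
  have d1' := fun i => (contDiff_pdP h' i).differentiable (by simp)
  simp only [pGen, laplP_eq_sum_pdP, pdP_mul d0 d0']
  have : ∀ i, pdP (fun y => φ y * pdP ψ y i + ψ y * pdP φ y i) x i =
      φ x * pdP (fun y => pdP ψ y i) x i + ψ x * pdP (fun y => pdP φ y i) x i
        + 2 * (pdP φ x i * pdP ψ x i) := by
    intro i
    rw [pdP_add (d0.fun_mul (d1' i)) (d0'.fun_mul (d1 i)), pdP_mul d0 (d1' i), pdP_mul d0' (d1 i)]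
    ring
  have e : ∀ i, x.2 i * (φ x * pdP ψ x i + ψ x * pdP φ x i) =
      φ x * (x.2 i * pdP ψ x i) + ψ x * (x.2 i * pdP φ x i) := fun i => by ring
  simp only [this, e, Finset.sum_add_distrib, ← Finset.mul_sum]
  ring

lemma pGen_comp_smul (φ : Phase d → ℝ) (h : ContDiff ℝ (⊤ : ℕ∞) φ) (m c : ℝ) (x : Phase d) :
    pGen m (fun y => φ (c • y)) x =
      c ^ 2 * laplP φ (c • x) - (1 / m) * ∑ i, (c • x).2 i * pdP φ (c • x) i := by
  have d1 : ∀ i, Differentiable ℝ (fun y => pdP φ (c • y) i) := fun i =>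
    ((contDiff_pdP h i).comp (contDiff_const_smul c)).differentiable (by simp)
  simp only [pGen, laplP_eq_sum_pdP, pdP_comp_smul φ, fun i => pdP_const_mul (d1 i),
    fun i => pdP_comp_smul (fun y => pdP φ y i), Finset.mul_sum]
  congr 1
  · exact Finset.sum_congr rfl fun i _ => by ring
  · exact Finset.sum_congr rfl fun i _ => by rw [Prod.smul_snd, Pi.smul_apply, smul_eq_mul]; ring

end Calculus

/-- A measure with zero relative Fisher information is stationary for the generator. -/
lemma integral_pGen_eq_zero {d : ℕ} {m : ℝ} {ν : Measure (Phase d)} [IsProbabilityMeasure ν]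
    (hfisher : relFisher m ν = 0) {φ : Phase d → ℝ} (h : IsTestFn φ) :
    ∫ x, pGen m φ x ∂ν = 0 := by
  have hle : ∀ ψ : Phase d → ℝ, IsTestFn ψ → ∫ x, fisherIntegrand m ψ x ∂ν ≤ 0 := by
    intro ψ hψ
    have := ENNReal.iSup_eq_zero.1 hfisher ⟨ψ, hψ⟩
    rw [ENNReal.ofReal_eq_zero] at this
    linarith
  set A := ∫ x, pGen m φ x ∂ν with hA
  set B := ∫ x, (1 / 2) * ∑ i, (pdP φ x i) ^ 2 ∂ν with hB
  have hB0 : 0 ≤ B := integral_nonneg fun x => by positivity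
  have key : ∀ c : ℝ, c * A - c ^ 2 * B ≤ 0 := by
    intro c
    refine le_trans (le_of_eq ?_) (hle _ (h.const_mul c))
    rw [hA, hB, ← integral_const_mul, ← integral_const_mul, ← integral_sub]
    · refine integral_congr_ae (Eventually.of_forall fun x => ?_)
      change _ = pGen m (fun y => c * φ y) x - _
      rw [pGen_const_mul h.1]
      simp only [pdP_const_mul h.differentiable, mul_pow, ← Finset.mul_sum]
      ring
    · exact (h.integrable_pGen m ν).const_mul _
    · exact ((h.integrable_sum_sq_pdP ν).const_mul _).const_mul _
  have h1 := key (A / (B + 1))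
  have h2 : A / (B + 1) * A - (A / (B + 1)) ^ 2 * B = (A / (B + 1)) ^ 2 := by
    field_simp
    ring
  rw [h2] at h1
  have h3 : A / (B + 1) = 0 := by nlinarith [sq_nonneg (A / (B + 1))]
  rcases div_eq_zero_iff.1 h3 with h4 | h4
  · exact h4
  · linarith

/-- Cutoffs increasing to `1` whose `p`-gradient and generator are uniformly bounded and vanish
eventually at each point. -/
lemma exists_cutoff (d : ℕ) (m : ℝ) : ∃ χ : ℕ → Phase d → ℝ,
    (∀ n, IsTestFn (χ n)) ∧ (∀ n x, |χ n x| ≤ 1) ∧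
    (∃ C, ∀ n x, |pGen m (χ n) x| ≤ C) ∧ (∃ C, ∀ n x i, |pdP (χ n) x i| ≤ C) ∧
    ∀ x, ∀ᶠ n in atTop, χ n x = 1 ∧ pGen m (χ n) x = 0 ∧ ∀ i, pdP (χ n) x i = 0 := by
  let f : ContDiffBump (0 : Phase d) := ⟨1, 2, one_pos, one_lt_two⟩
  have hf : IsTestFn (f : Phase d → ℝ) := ⟨f.contDiff, f.hasCompactSupport⟩
  let ε : ℕ → ℝ := fun n => 1 / ((n : ℝ) + 1)
  have ε0 : ∀ n, 0 < ε n := fun n => Nat.one_div_pos_of_nat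
  have ε1 : ∀ n, ε n ≤ 1 := fun n => by
    simpa [ε] using inv_le_one_of_one_le₀ (by linarith [(Nat.cast_nonneg n : (0 : ℝ) ≤ n)])
  have εlim : Tendsto ε atTop (𝓝 0) := tendsto_one_div_add_atTop_nhds_zero_nat
  refine ⟨fun n x => f (ε n • x), fun n => hf.comp_smul (ε0 n).ne', fun n x => ?_, ?_, ?_, ?_⟩
  · rw [abs_of_nonneg f.nonneg]; exact f.le_one
  · choose C1 hC1 using fun i => ((hf.pd i).pd i).exists_abs_le
    choose C2 hC2 using fun i => (hf.pd i).exists_abs_mul_le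
      (g := fun x : Phase d => x.2 i) (by fun_prop)
    refine ⟨∑ i, C1 i + |1 / m| * ∑ i, C2 i, fun n x => ?_⟩
    rw [pGen_comp_smul _ hf.1]
    refine (abs_sub _ _).trans (add_le_add ?_ ?_)
    · rw [abs_mul, laplP_eq_sum_pdP]
      refine (mul_le_of_le_one_left (abs_nonneg _) ?_).trans
        ((Finset.abs_sum_le_sum_abs _ _).trans (Finset.sum_le_sum fun i _ => hC1 i _))
      rw [abs_of_nonneg (sq_nonneg _)]
      exact pow_le_one₀ (ε0 n).le (ε1 n)
    · rw [abs_mul]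
      exact mul_le_mul_of_nonneg_left
        ((Finset.abs_sum_le_sum_abs _ _).trans (Finset.sum_le_sum fun i _ => hC2 i _))
        (abs_nonneg _)
  · choose C hC using fun i => (hf.pd i).exists_abs_le
    refine ⟨∑ i, C i, fun n x i => ?_⟩
    rw [pdP_comp_smul, abs_mul, abs_of_pos (ε0 n)]
    refine (mul_le_of_le_one_left (abs_nonneg _) (ε1 n)).trans ((hC i _).trans ?_)
    exact Finset.single_le_sum (fun j _ => (abs_nonneg _).trans (hC j 0)) (Finset.mem_univ i)
  · intro x
    have hx : Tendsto (fun n => ε n • x) atTop (𝓝 0) := by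
      simpa using εlim.smul_const x
    filter_upwards [hx (Metric.ball_mem_nhds 0 one_pos)] with n hn
    have e1 : (f : Phase d → ℝ) =ᶠ[𝓝 (ε n • x)] fun _ => 1 := f.eventuallyEq_one_of_mem_ball hn
    have e2 : ∀ i, (fun y => pdP f y i) =ᶠ[𝓝 (ε n • x)] fun _ => 0 := by
      intro i
      filter_upwards [e1.fderiv (𝕜 := ℝ)] with y hy
      simp [pdP, hy]
    have e3 : ∀ i, pdP (fun y => pdP f y i) (ε n • x) i = 0 := by
      intro i
      rw [pdP, (e2 i).fderiv_eq (𝕜 := ℝ)]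
      simp
    refine ⟨e1.self_of_nhds, ?_, fun i => ?_⟩
    · rw [pGen_comp_smul _ hf.1, laplP_eq_sum_pdP]
      simp [e3, fun i => show pdP f (ε n • x) i = 0 from (e2 i).self_of_nhds]
    · simp [pdP_comp_smul, show pdP f (ε n • x) i = 0 from (e2 i).self_of_nhds]

/-- A limit `h` of approximate solutions of `s² N H + (s/m) H' = 0` on `[0, 1]`, continuous at `0`,
is the Gaussian solution `h s = h 0 * exp (-m N s² / 2)`; stated at `s = 1`. -/
lemma exp_mul_eq_of_approx {m N : ℝ} (hm : 0 < m) (hN : 0 ≤ N) {H H' : ℕ → ℝ → ℝ} {η : ℕ → ℝ}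
    {h : ℝ → ℝ} (hd : ∀ n s, HasDerivAt (H n) (H' n s) s)
    (he : ∀ n, ∀ s ∈ Icc (0 : ℝ) 1, |s ^ 2 * N * H n s + s / m * H' n s| ≤ η n)
    (hη : Tendsto η atTop (𝓝 0)) (hlim : ∀ s, Tendsto (fun n => H n s) atTop (𝓝 (h s)))
    (hc : ContinuousAt h 0) : Real.exp (m * N / 2) * h 1 = h 0 := by
  let E : ℝ → ℝ := fun s => Real.exp (m * N / 2 * s ^ 2)
  have hE : ∀ s, HasDerivAt E (E s * (m * N * s)) s := by
    intro s
    have := (((hasDerivAt_id s).pow 2).const_mul (m * N / 2)).exp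
    refine this.congr_deriv ?_
    simp [E]
    ring
  have hconst : ∀ δ ∈ Ioc (0 : ℝ) 1, E 1 * h 1 = E δ * h δ := by
    intro δ hδ
    have bound : ∀ n, |E 1 * H n 1 - E δ * H n δ| ≤ E 1 * (m / δ * η n) * |1 - δ| := by
      intro n
      refine (convex_Icc δ 1).norm_image_sub_le_of_norm_hasDerivWithin_le
        (f := fun s => E s * H n s) (f' := fun s => E s * (m * N * s) * H n s + E s * H' n s)
        (fun s _ => ((hE s).mul (hd n s)).hasDerivWithinAt) (fun s hs => ?_)
        (left_mem_Icc.2 hδ.2) (right_mem_Icc.2 hδ.2)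
      have hs0 : 0 < s := hδ.1.trans_le hs.1
      have e : E s * (m * N * s) * H n s + E s * H' n s =
          E s * (m / s * (s ^ 2 * N * H n s + s / m * H' n s)) := by
        field_simp
      rw [e, Real.norm_eq_abs, abs_mul, abs_mul, abs_of_pos (div_pos hm hs0),
        abs_of_pos (Real.exp_pos _)]
      have h1 := he n s ⟨hs0.le, hs.2⟩
      have h2 : E s ≤ E 1 := by
        refine Real.exp_le_exp.2 (mul_le_mul_of_nonneg_left ?_ (by positivity))
        exact pow_le_pow_left₀ hs0.le hs.2 2
      have h3 : m / s ≤ m / δ := div_le_div_of_nonneg_left hm.le hδ.1 hs.1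
      have h4 : 0 < m / s := div_pos hm hs0
      have h5 : 0 < E s := Real.exp_pos _
      have h6 : 0 ≤ m / δ := h4.le.trans h3
      gcongr
    have l1 : Tendsto (fun n => |E 1 * H n 1 - E δ * H n δ|) atTop
        (𝓝 |E 1 * h 1 - E δ * h δ|) :=
      (((hlim 1).const_mul _).sub ((hlim δ).const_mul _)).abs
    have l2 : Tendsto (fun n => E 1 * (m / δ * η n) * |1 - δ|) atTop (𝓝 0) := by
      simpa using ((hη.const_mul (m / δ)).const_mul (E 1)).mul_const |1 - δ|
    have := le_of_tendsto_of_tendsto' l1 l2 bound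
    exact sub_eq_zero.1 (abs_nonpos_iff.1 this)
  have l0 : Tendsto (fun s => E s * h s) (𝓝[>] 0) (𝓝 (E 0 * h 0)) :=
    ((hE 0).continuousAt.mul hc).tendsto.mono_left nhdsWithin_le_nhds
  have l1 : Tendsto (fun s => E s * h s) (𝓝[>] 0) (𝓝 (E 1 * h 1)) := by
    refine tendsto_const_nhds.congr' ?_
    filter_upwards [Ioc_mem_nhdsGT (zero_lt_one' ℝ)] with s hs using hconst s hs
  simpa [E] using tendsto_nhds_unique l1 l0

section Cosine

variable {d : ℕ}

lemma pdP_cos (M : Phase d →L[ℝ] ℝ) (c : ℝ) (x : Phase d) (i : Fin d) :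
    pdP (fun y => Real.cos (M y + c)) x i = -Real.sin (M x + c) * M (dirP i) := by
  have := ((M.hasFDerivAt (x := x)).add_const c).cos
  simp [pdP, this.fderiv]

lemma pdP_sin (M : Phase d →L[ℝ] ℝ) (c : ℝ) (x : Phase d) (i : Fin d) :
    pdP (fun y => Real.sin (M y + c)) x i = Real.cos (M x + c) * M (dirP i) := by
  have := ((M.hasFDerivAt (x := x)).add_const c).sin
  simp [pdP, this.fderiv]

lemma pGen_cos (m : ℝ) (M : Phase d →L[ℝ] ℝ) (c : ℝ) (x : Phase d) :
    pGen m (fun y => Real.cos (M y + c)) x =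
      -Real.cos (M x + c) * ∑ i, (M (dirP i)) ^ 2 +
        1 / m * (Real.sin (M x + c) * ∑ i, x.2 i * M (dirP i)) := by
  have e : ∀ i, (fun y => pdP (fun y => Real.cos (M y + c)) y i) =
      fun y => (-M (dirP i)) * Real.sin (M y + c) := fun i => by
    funext y
    rw [pdP_cos]
    ring
  have hs : Differentiable ℝ (fun y : Phase d => Real.sin (M y + c)) := by fun_prop
  have e' : ∀ i, pdP (fun y => pdP (fun y => Real.cos (M y + c)) y i) x i =
      (-M (dirP i)) * (Real.cos (M x + c) * M (dirP i)) := fun i => by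
    rw [e, pdP_const_mul hs, pdP_sin]
  simp only [pGen, laplP_eq_sum_pdP, e']
  simp only [pdP_cos, Finset.mul_sum]
  rw [sub_eq_add_neg, ← Finset.sum_neg_distrib]
  congr 1 <;> exact Finset.sum_congr rfl fun i _ => by ring

/-- Stationarity tested on `cos (s K + B + θ)`, with `K` depending on `p` only and `B` on `q` only,
determines the `K`-dependence of its integral. -/
lemma exp_mul_integral_cos {m : ℝ} (hm : 0 < m) {ν : Measure (Phase d)} [IsProbabilityMeasure ν]
    (hfisher : relFisher m ν = 0) (K B : Phase d →L[ℝ] ℝ) (hB : ∀ i, B (dirP i) = 0)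
    (hK : ∀ x, K x = ∑ i, x.2 i * K (dirP i)) (θ : ℝ) :
    Real.exp (m * (∑ i, (K (dirP i)) ^ 2) / 2) * ∫ x, Real.cos (K x + (B x + θ)) ∂ν =
      ∫ x, Real.cos (B x + θ) ∂ν := by
  obtain ⟨χ, hχ, hχ1, ⟨C, hC⟩, ⟨D, hD⟩, hev⟩ := exists_cutoff d m
  set N := ∑ i, (K (dirP i)) ^ 2 with hNdef
  let u : ℝ → Phase d → ℝ := fun s x => (s • K + B) x + θ
  have hu : ∀ s x, u s x = s * K x + (B x + θ) := fun s x => by simp [u, add_assoc]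
  have ucont : ∀ s, Continuous (u s) := fun s => by fun_prop
  have usmooth : ∀ s, ContDiff ℝ (⊤ : ℕ∞) (fun x => Real.cos (u s x)) := fun s =>
    Real.contDiff_cos.comp ((s • K + B).contDiff.add contDiff_const)
  let R : ℕ → Phase d → ℝ := fun n x =>
    |pGen m (χ n) x| + 2 * |∑ i, pdP (χ n) x i * K (dirP i)|
  have Rcont : ∀ n, Continuous (R n) := fun n => by
    have h1 := (hχ n).continuous_pGen m
    have h2 := fun i => ((hχ n).pd i).continuous
    fun_prop
  have Rbound : ∀ n x, ‖R n x‖ ≤ C + 2 * ∑ i, D * |K (dirP i)| := by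
    intro n x
    rw [Real.norm_of_nonneg (by positivity)]
    refine add_le_add (hC n x) (mul_le_mul_of_nonneg_left ?_ two_pos.le)
    refine (Finset.abs_sum_le_sum_abs _ _).trans (Finset.sum_le_sum fun i _ => ?_)
    rw [abs_mul]
    exact mul_le_mul_of_nonneg_right (hD n x i) (abs_nonneg _)
  have Rint : ∀ n, Integrable (R n) ν := fun n =>
    Integrable.of_bound (Rcont n).aestronglyMeasurable _ (Eventually.of_forall (Rbound n))
  have Rlim : Tendsto (fun n => ∫ x, R n x ∂ν) atTop (𝓝 0) := by
    have := tendsto_integral_of_dominated_convergence (μ := ν) (F := R) (f := fun _ => 0)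
      (fun _ => C + 2 * ∑ i, D * |K (dirP i)|) (fun n => (Rcont n).aestronglyMeasurable)
      (integrable_const _) (fun n => Eventually.of_forall (Rbound n))
      (Eventually.of_forall fun x => tendsto_const_nhds.congr' (by
        filter_upwards [hev x] with n hn
        simp [R, hn.2.1, hn.2.2]))
    simpa using this
  have hderiv : ∀ n s, HasDerivAt (fun s => ∫ x, χ n x * Real.cos (u s x) ∂ν)
      (∫ x, χ n x * (-Real.sin (u s x) * K x) ∂ν) s := by
    intro n s
    refine (hasDerivAt_integral_of_dominated_loc_of_deriv_le (μ := ν) (s := univ)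
      (F := fun s x => χ n x * Real.cos (u s x))
      (F' := fun s x => χ n x * (-Real.sin (u s x) * K x))
      (bound := fun x => |K x * χ n x|) univ_mem
      (Eventually.of_forall fun t => ?_) ?_ ?_ (Eventually.of_forall fun x t _ => ?_) ?_
      (Eventually.of_forall fun x t _ => ?_)).2
    · exact ((hχ n).continuous.mul
        (Real.continuous_cos.comp (ucont t))).aestronglyMeasurable
    · exact ((hχ n).mul_contDiff (usmooth s)).integrable ν
    · exact ((hχ n).continuous.mul
        ((Real.continuous_sin.comp (ucont s)).neg.mul K.continuous)).aestronglyMeasurable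
    · rw [Real.norm_eq_abs, show χ n x * (-Real.sin (u t x) * K x) =
        -Real.sin (u t x) * (K x * χ n x) by ring, abs_mul, abs_neg]
      exact mul_le_of_le_one_left (abs_nonneg _) (Real.abs_sin_le_one _)
    · exact ((hχ n).integrable_mul K.continuous ν).abs
    · refine HasDerivAt.const_mul _ (HasDerivAt.cos ?_)
      simp only [hu]
      simpa using ((hasDerivAt_id t).mul_const (K x)).add_const (B x + θ)
  have herr : ∀ n, ∀ s ∈ Icc (0 : ℝ) 1, ∀ x, ‖Real.cos (u s x) * pGen m (χ n) x -
      2 * (s * Real.sin (u s x) * ∑ i, pdP (χ n) x i * K (dirP i))‖ ≤ R n x := by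
    intro n s hs x
    refine (norm_sub_le _ _).trans (add_le_add ?_ ?_)
    · rw [Real.norm_eq_abs, abs_mul]
      exact mul_le_of_le_one_left (abs_nonneg _) (Real.abs_cos_le_one _)
    · rw [Real.norm_eq_abs, abs_mul, abs_mul, abs_mul s, abs_two, abs_of_nonneg hs.1]
      exact mul_le_mul_of_nonneg_left (mul_le_of_le_one_left (abs_nonneg _)
        (mul_le_one₀ hs.2 (abs_nonneg _) (Real.abs_sin_le_one _))) two_pos.le
  have hident : ∀ n, ∀ s ∈ Icc (0 : ℝ) 1, s ^ 2 * N * ∫ x, χ n x * Real.cos (u s x) ∂ν +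
      s / m * ∫ x, χ n x * (-Real.sin (u s x) * K x) ∂ν =
      ∫ x, (Real.cos (u s x) * pGen m (χ n) x -
        2 * (s * Real.sin (u s x) * ∑ i, pdP (χ n) x i * K (dirP i))) ∂ν := by
    intro n s hs
    have h0 := integral_pGen_eq_zero hfisher ((hχ n).mul_contDiff (usmooth s))
    have hpt : ∀ x, pGen m (fun y => χ n y * Real.cos (u s y)) x =
        (Real.cos (u s x) * pGen m (χ n) x -
          2 * (s * Real.sin (u s x) * ∑ i, pdP (χ n) x i * K (dirP i))) -
        (s ^ 2 * N * (χ n x * Real.cos (u s x)) +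
          s / m * (χ n x * (-Real.sin (u s x) * K x))) := by
      intro x
      have hM : ∀ i, (s • K + B) (dirP i) = s * K (dirP i) := fun i => by simp [hB]
      rw [pGen_mul (hχ n).1 (usmooth s), pGen_cos]
      have hpd : ∀ i, pdP (fun y => Real.cos (u s y)) x i =
          -Real.sin (u s x) * (s * K (dirP i)) := fun i =>
        (pdP_cos (s • K + B) θ x i).trans (by rw [hM])
      simp only [hpd, hM]
      have e1 : ∑ i, (s * K (dirP i)) ^ 2 = s ^ 2 * N := by
        simp only [mul_pow, hNdef, Finset.mul_sum]
      have e2 : ∑ i, x.2 i * (s * K (dirP i)) = s * K x := by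
        rw [hK x, Finset.mul_sum]
        exact Finset.sum_congr rfl fun i _ => by ring
      have e3 : ∑ i, pdP (χ n) x i * (-Real.sin (u s x) * (s * K (dirP i))) =
          -(s * Real.sin (u s x) * ∑ i, pdP (χ n) x i * K (dirP i)) := by
        rw [Finset.mul_sum, ← Finset.sum_neg_distrib]
        exact Finset.sum_congr rfl fun i _ => by ring
      rw [e1, e2, e3]
      ring
    have i1 : Integrable (fun x => χ n x * Real.cos (u s x)) ν :=
      ((hχ n).mul_contDiff (usmooth s)).integrable ν
    have i2 : Integrable (fun x => χ n x * (-Real.sin (u s x) * K x)) ν := by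
      simp only [mul_comm (χ n _)]
      exact (hχ n).integrable_mul
        ((Real.continuous_sin.comp (ucont s)).neg.mul K.continuous) ν
    have i3 : Integrable (fun x => Real.cos (u s x) * pGen m (χ n) x -
        2 * (s * Real.sin (u s x) * ∑ i, pdP (χ n) x i * K (dirP i))) ν :=
      (Rint n).mono' ((by
        have h1 := (hχ n).continuous_pGen m
        have h2 := fun i => ((hχ n).pd i).continuous
        fun_prop : Continuous _).aestronglyMeasurable) (Eventually.of_forall (herr n s hs))
    have i12 : Integrable (fun x => s ^ 2 * N * (χ n x * Real.cos (u s x)) +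
        s / m * (χ n x * (-Real.sin (u s x) * K x))) ν :=
      (i1.const_mul _).add (i2.const_mul _)
    rw [integral_congr_ae (Eventually.of_forall hpt), integral_sub i3 i12,
      integral_add (i1.const_mul _) (i2.const_mul _),
      integral_const_mul, integral_const_mul] at h0
    linarith
  have hmain := exp_mul_eq_of_approx hm (N := N)
    (H := fun n s => ∫ x, χ n x * Real.cos (u s x) ∂ν)
    (H' := fun n s => ∫ x, χ n x * (-Real.sin (u s x) * K x) ∂ν)
    (η := fun n => ∫ x, R n x ∂ν) (h := fun s => ∫ x, Real.cos (u s x) ∂ν)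
    (Finset.sum_nonneg fun i _ => sq_nonneg _) hderiv (fun n s hs => ?_) Rlim (fun s => ?_) ?_
  · simpa [hu] using hmain
  · rw [hident n s hs, ← Real.norm_eq_abs]
    exact norm_integral_le_of_norm_le (Rint n) (Eventually.of_forall (herr n s hs))
  · refine tendsto_integral_of_dominated_convergence (fun _ => 1)
      (fun n => ((hχ n).continuous.mul
        (Real.continuous_cos.comp (ucont s))).aestronglyMeasurable)
      (integrable_const _) (fun n => Eventually.of_forall fun x => ?_)
      (Eventually.of_forall fun x => tendsto_const_nhds.congr' ?_)
    · rw [Real.norm_eq_abs, abs_mul]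
      exact mul_le_one₀ (hχ1 n x) (abs_nonneg _) (Real.abs_cos_le_one _)
    · filter_upwards [hev x] with n hn
      simp [hn.1]
  · refine Continuous.continuousAt (continuous_of_dominated (bound := fun _ => 1)
      (fun s => (Real.continuous_cos.comp (ucont s)).aestronglyMeasurable)
      (fun s => Eventually.of_forall fun x => Real.abs_cos_le_one _) (integrable_const _)
      (Eventually.of_forall fun x => ?_))
    simp only [hu]
    fun_prop

end Cosine

section Maxwellian

variable {d : ℕ} {m : ℝ}

lemma integral_cexp_maxwell_eq_cpow (hm : 0 < m) (c : Fin d → ℂ) :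
    ∫ p : Fin d → ℝ, Complex.exp (-(∑ i, (p i : ℂ) ^ 2) / (2 * m) + ∑ i, c i * p i) =
      (π / (1 / (2 * m) : ℂ)) ^ (Fintype.card (Fin d) / 2 : ℂ) *
        Complex.exp (m * (∑ i, c i ^ 2) / 2) := by
  have hb : 0 < (1 / (2 * m) : ℂ).re := by
    rw [show (1 / (2 * m) : ℂ) = ((1 / (2 * m) : ℝ) : ℂ) by push_cast; rfl, Complex.ofReal_re]
    positivity
  have hm' : (m : ℂ) ≠ 0 := by exact_mod_cast hm.ne'
  rw [show m * (∑ i, c i ^ 2) / 2 = (∑ i, c i ^ 2) / (4 * (1 / (2 * m) : ℂ)) by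
    field_simp; ring, ← GaussianFourier.integral_cexp_neg_mul_sum_add hb c]
  congr 1 with p
  congr 2
  ring

lemma ofReal_maxwellZ (hm : 0 < m) :
    (maxwellZ d m : ℂ) = (π / (1 / (2 * m) : ℂ)) ^ (Fintype.card (Fin d) / 2 : ℂ) := by
  have := integral_cexp_maxwell_eq_cpow (d := d) hm 0
  simp only [Pi.zero_apply, zero_mul, Finset.sum_const_zero, add_zero, ne_eq,
    OfNat.ofNat_ne_zero, not_false_eq_true, zero_pow, mul_zero, zero_div, Complex.exp_zero,
    mul_one] at this
  rw [← this, maxwellZ, ← integral_complex_ofReal]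
  push_cast
  rfl

lemma integral_cexp_maxwell (hm : 0 < m) (c : Fin d → ℂ) :
    ∫ p : Fin d → ℝ, Complex.exp (-(∑ i, (p i : ℂ) ^ 2) / (2 * m) + ∑ i, c i * p i) =
      (maxwellZ d m : ℂ) * Complex.exp (m * (∑ i, c i ^ 2) / 2) := by
  rw [integral_cexp_maxwell_eq_cpow hm, ofReal_maxwellZ hm]

lemma maxwellZ_pos (hm : 0 < m) : 0 < maxwellZ d m := by
  refine (integral_nonneg fun p => (Real.exp_pos _).le).lt_of_ne' fun h => ?_
  have h1 := ofReal_maxwellZ (d := d) hm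
  rw [← maxwellZ] at h
  rw [h, Complex.ofReal_zero, eq_comm, Complex.cpow_eq_zero_iff] at h1
  have hm' : (m : ℂ) ≠ 0 := by exact_mod_cast hm.ne'
  have hπ : (π : ℂ) ≠ 0 := by exact_mod_cast Real.pi_ne_zero
  refine absurd h1.1 (div_ne_zero hπ (one_div_ne_zero (mul_ne_zero two_ne_zero hm')))

lemma integrable_maxwell (hm : 0 < m) :
    Integrable fun p : Fin d → ℝ => Real.exp (-(∑ i, (p i) ^ 2) / (2 * m)) :=
  not_imp_comm.1 integral_undef (maxwellZ_pos hm).ne'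

lemma isProbabilityMeasure_maxwellian (hm : 0 < m) : IsProbabilityMeasure (maxwellian d m) := by
  constructor
  rw [maxwellian, withDensity_apply _ MeasurableSet.univ, Measure.restrict_univ,
    ← ofReal_integral_eq_lintegral_ofReal ((integrable_maxwell hm).const_mul _)
      (Eventually.of_forall fun p =>
        mul_nonneg (inv_nonneg.2 (maxwellZ_pos hm).le) (Real.exp_pos _).le),
    integral_const_mul, ← maxwellZ, inv_mul_cancel₀ (maxwellZ_pos hm).ne', ENNReal.ofReal_one]

/-- The Maxwellian is a centred Gaussian with covariance `m`. -/
lemma charFunDual_maxwellian (hm : 0 < m) (L : StrongDual ℝ (Fin d → ℝ)) :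
    charFunDual (maxwellian d m) L =
      (Real.exp (-(m * (∑ i, (L (Pi.single i 1)) ^ 2) / 2)) : ℝ) := by
  have hZ : (maxwellZ d m : ℂ) ≠ 0 := by exact_mod_cast (maxwellZ_pos hm).ne'
  have hL : ∀ p, L p = ∑ i, p i * L (Pi.single i 1) := fun p => by
    conv_lhs => rw [pi_eq_sum_univ' p]
    simp
  rw [charFunDual_apply, maxwellian, integral_withDensity_eq_integral_toReal_smul
    (by fun_prop) (by simp)]
  have h1 := integral_cexp_maxwell hm fun i => (L (Pi.single i (1 : ℝ)) : ℂ) * Complex.I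
  have e : ∀ p : Fin d → ℝ, (ENNReal.ofReal ((maxwellZ d m)⁻¹ *
      Real.exp (-(∑ i, (p i) ^ 2) / (2 * m)))).toReal • Complex.exp (L p * Complex.I) =
      (maxwellZ d m : ℂ)⁻¹ * Complex.exp (-(∑ i, (p i : ℂ) ^ 2) / (2 * m) +
        ∑ i, (L (Pi.single i (1 : ℝ)) : ℂ) * Complex.I * p i) := by
    intro p
    rw [ENNReal.toReal_ofReal
      (mul_nonneg (inv_nonneg.2 (maxwellZ_pos hm).le) (Real.exp_pos _).le), Complex.real_smul,
      Complex.exp_add, hL p]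
    push_cast
    rw [mul_assoc, Finset.sum_mul]
    congr 4
    funext i
    ring
  simp only [e]
  rw [integral_const_mul, h1, inv_mul_cancel_left₀ hZ, Complex.ofReal_exp]
  congr 1
  push_cast
  simp only [mul_pow, Complex.I_sq, mul_neg, mul_one, Finset.sum_neg_distrib]
  ring

end Maxwellian

lemma charFunDual_eq_integral_cos_sin {E : Type*} [NormedAddCommGroup E] [NormedSpace ℝ E]
    [MeasurableSpace E] [BorelSpace E] [SecondCountableTopology E]
    (ν : Measure E) [IsFiniteMeasure ν] (L : StrongDual ℝ E) :
    charFunDual ν L = (∫ x, Real.cos (L x) ∂ν : ℝ) + (∫ x, Real.sin (L x) ∂ν : ℝ) * Complex.I := by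
  have hc : Integrable (fun x => Real.cos (L x)) ν :=
    Integrable.of_bound (by fun_prop) 1 (Eventually.of_forall fun x => Real.abs_cos_le_one _)
  have hs : Integrable (fun x => Real.sin (L x)) ν :=
    Integrable.of_bound (by fun_prop) 1 (Eventually.of_forall fun x => Real.abs_sin_le_one _)
  rw [charFunDual_apply, ← integral_complex_ofReal, ← integral_complex_ofReal,
    ← integral_mul_const, ← integral_add hc.ofReal (hs.ofReal.mul_const _)]
  simp [Complex.exp_mul_I]

/-- Lemma 2.2, zero relative Fisher information implies Maxwellian:
if `ν ∈ P(ℝ^{2d})` satisfies `I(ν|μ) = 0`, then there is `σ ∈ P(ℝ^d)` with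
`ν(dq dp) = Z⁻¹ e^{−p²/(2m)} σ(dq) dp`, i.e. `ν = σ ⊗ (Maxwellian)`. -/
theorem stmt1 {d : ℕ} (hd : 1 ≤ d) {m : ℝ} (hm : 0 < m)
    (ν : Measure (Phase d)) [IsProbabilityMeasure ν]
    (hfisher : relFisher m ν = 0) :
    ∃ σ : Measure (Fin d → ℝ), IsProbabilityMeasure σ ∧
      ν = σ.prod (maxwellian d m) := by
  have := isProbabilityMeasure_maxwellian (d := d) hm
  refine ⟨ν.map Prod.fst, Measure.isProbabilityMeasure_map measurable_fst.aemeasurable, ?_⟩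
  have : IsProbabilityMeasure (ν.map Prod.fst) :=
    Measure.isProbabilityMeasure_map measurable_fst.aemeasurable
  refine Measure.ext_of_charFunDual (funext fun L => ?_)
  let A := L.comp (.inl ℝ (Fin d → ℝ) (Fin d → ℝ))
  let P := L.comp (.inr ℝ (Fin d → ℝ) (Fin d → ℝ))
  let B := A.comp (.fst ℝ (Fin d → ℝ) (Fin d → ℝ))
  let K := P.comp (.snd ℝ (Fin d → ℝ) (Fin d → ℝ))
  have hKdir : ∀ i, K (dirP i) = P (Pi.single i 1) := fun i => rfl
  have hL : ∀ x, L x = K x + B x := fun x => by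
    rw [← L.comp_inl_add_comp_inr, add_comm]
    rfl
  have hcos := exp_mul_integral_cos hm hfisher K B (fun i => by simp [B, dirP]) (fun x => by
    simp only [hKdir]
    conv_lhs => rw [show K x = P x.2 from rfl, pi_eq_sum_univ' x.2]
    simp)
  have h0 := hcos 0
  have h1 := hcos (-(π / 2))
  simp only [add_zero, ← hL, hKdir] at h0
  have hsin : ∀ x, Real.cos (K x + (B x + -(π / 2))) = Real.sin (L x) := fun x => by
    rw [← add_assoc, ← hL, ← sub_eq_add_neg, Real.cos_sub_pi_div_two]
  simp only [hsin, hKdir] at h1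
  simp only [← sub_eq_add_neg, Real.cos_sub_pi_div_two] at h1
  have hσ : charFunDual (ν.map Prod.fst) A = charFunDual ν B :=
    charFunDual_map (ContinuousLinearMap.fst ℝ (Fin d → ℝ) (Fin d → ℝ)) A
  rw [charFunDual_prod, charFunDual_maxwellian hm, hσ, charFunDual_eq_integral_cos_sin ν L,
    charFunDual_eq_integral_cos_sin ν B, ← h0, ← h1, Real.exp_neg]
  change _ = _ * (((Real.exp (m * (∑ i, (P (Pi.single i 1)) ^ 2) / 2))⁻¹ : ℝ) : ℂ)
  generalize hE : Real.exp (m * (∑ i, (P (Pi.single i 1)) ^ 2) / 2) = E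
  have hE0 : (E : ℂ) ≠ 0 := by exact_mod_cast hE ▸ (Real.exp_pos _).ne'
  rw [Complex.ofReal_mul, Complex.ofReal_mul, Complex.ofReal_inv]
  field_simp
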